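/- Let G be a connected graph with an injective vertex priority function p : V(G) → ℝ. Define the edge weight function w^min_p by w^min_p({u,v}) = min(p(u), p(v)). If H is a maximum spanning tree of (G, w^min_p) (a spanning tree maximizing the total edge weight), then Ind(G,p) = Ind(H,p). -/

import Mathlib

/-- A rooted tree on a node set `α`, given by its root and parent function
(the root is its own parent, and every node reaches the root by iterating `parent`). -/
structure RTree (α : Type*) where
  root : α
  parent : α → α
  parent_root : parent root = root
  reaches_root : ∀ v, ∃ k, parent^[k] v = root

namespace RTree

variable {α : Type*}

/-- `u` is a (weak) ancestor of `v` in `T`. -/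
def ancestor (T : RTree α) (u v : α) : Prop := ∃ k, T.parent^[k] v = u

/-- `u` is a proper ancestor of `v` in `T`. -/
def properAncestor (T : RTree α) (u v : α) : Prop := T.ancestor u v ∧ u ≠ v

/-- The node set of the subtree `T_v` of `T` rooted at `v`,
i.e. `v` together with all of its descendants. -/
def subtree (T : RTree α) (v : α) : Set α := {u | T.ancestor v u}

/-- A leaf of `T` is a node with no children. -/
def IsLeaf (T : RTree α) (v : α) : Prop := ∀ u, T.parent u = v → u = v

end RTree

/-- `T` is an elimination tree on the (connected) graph `G`: every subtree of `T` induces a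
connected subgraph of `G`, and every edge of `G` joins an ancestor-descendant pair of `T`.
(For connected `G` this is equivalent to the recursive definition: some vertex `r` is the
root, and the child subtrees of `r` are elimination trees on the components of `G − r`.) -/
def IsElimTree {α : Type*} (G : SimpleGraph α) (T : RTree α) : Prop :=
  (∀ v : α, (G.induce (T.subtree v)).Connected) ∧
  (∀ u v : α, G.Adj u v → T.ancestor u v ∨ T.ancestor v u)

/-- `T` is the Cartesian tree `Ind(G,p)`: the (unique) elimination tree on `G` in which
`p(u) < p(v)` whenever `u` is a proper ancestor of `v`. -/
def IsCartesianTree {α : Type*} (G : SimpleGraph α) (p : α → ℝ) (T : RTree α) : Prop :=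
  IsElimTree G T ∧ ∀ u v : α, T.properAncestor u v → p u < p v

/-- `T` is a rooting of the tree `G`: the parent-child pairs of `T` are exactly the edges
of `G`. -/
def IsRooting {α : Type*} (G : SimpleGraph α) (T : RTree α) : Prop :=
  ∀ u v : α, G.Adj u v ↔ ((T.parent u = v ∧ u ≠ v) ∨ (T.parent v = u ∧ v ≠ u))

/-- `p` is a `T`-monotone priority function: `p` is injective and `p(v) < p(u)` whenever
`u` is a proper ancestor of `v` in `T`. -/
def IsMonotonePriority {α : Type*} (T : RTree α) (p : α → ℝ) : Prop :=
  Function.Injective p ∧ ∀ u v : α, T.properAncestor u v → p v < p u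

/-- The edge weight function `w^min_p` induced by vertex priorities `p`:
`w^min_p({u,v}) = min(p u, p v)`. -/
noncomputable def wmin {α : Type*} (p : α → ℝ) : Sym2 α → ℝ :=
  Sym2.lift ⟨fun u v => min (p u) (p v), fun u v => min_comm (p u) (p v)⟩

namespace RTree

variable {α : Type*} {T : RTree α} {u v w : α}

theorem ancestor_refl (v : α) : T.ancestor v v := ⟨0, rfl⟩

theorem ancestor.trans (h₁ : T.ancestor u v) (h₂ : T.ancestor v w) : T.ancestor u w := by
  obtain ⟨k, rfl⟩ := h₁
  obtain ⟨l, rfl⟩ := h₂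
  exact ⟨k + l, Function.iterate_add_apply _ _ _ _⟩

/-- The ancestors of a node form a chain. -/
theorem ancestor.comparable (h₁ : T.ancestor u w) (h₂ : T.ancestor v w) :
    T.ancestor u v ∨ T.ancestor v u := by
  obtain ⟨k, rfl⟩ := h₁
  obtain ⟨l, rfl⟩ := h₂
  obtain h | h := le_total l k
  · exact .inl ⟨k - l, by rw [← Function.iterate_add_apply, Nat.sub_add_cancel h]⟩
  · exact .inr ⟨l - k, by rw [← Function.iterate_add_apply, Nat.sub_add_cancel h]⟩

end RTree

/-- `v` can be reached from `u` in `G` by steps that end in vertices of priority at least `t`. -/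
def ReachableAbove {α : Type*} (G : SimpleGraph α) (p : α → ℝ) (t : ℝ) : α → α → Prop :=
  Relation.ReflTransGen fun x y => G.Adj x y ∧ t ≤ p y

section Characterization

variable {α : Type*} {G : SimpleGraph α} {p : α → ℝ} {T : RTree α} {u v : α} {t : ℝ}

theorem ReachableAbove.le (h : ReachableAbove G p t u v) (hu : t ≤ p u) : t ≤ p v := by
  obtain rfl | ⟨_, _, h⟩ := h.cases_tail
  · exact hu
  · exact h.2

theorem IsCartesianTree.le_of_ancestor (hT : IsCartesianTree G p T) (h : T.ancestor u v) :
    p u ≤ p v := by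
  by_cases huv : u = v
  · rw [huv]
  · exact (hT.2 u v ⟨h, huv⟩).le

theorem IsCartesianTree.reachableAbove_of_ancestor (hT : IsCartesianTree G p T)
    (h : T.ancestor u v) : ReachableAbove G p (p u) u v := by
  have hr := (hT.1.1 u).preconnected ⟨u, RTree.ancestor_refl u⟩ ⟨v, h⟩
  rw [SimpleGraph.reachable_iff_reflTransGen] at hr
  exact hr.lift Subtype.val fun x y hxy => ⟨hxy, hT.le_of_ancestor y.2⟩

theorem IsCartesianTree.ancestor_of_reachableAbove (hT : IsCartesianTree G p T)
    (h : ReachableAbove G p (p u) u v) : T.ancestor u v := by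
  induction h with
  | refl => exact RTree.ancestor_refl u
  | @tail x y _ hxy ih =>
    obtain h | h := hT.1.2 x y hxy.1
    · exact ih.trans h
    · obtain h' | h' := ih.comparable h
      · exact h'
      · by_cases hyu : y = u
        · exact hyu ▸ RTree.ancestor_refl y
        · exact absurd hxy.2 (hT.2 y u ⟨h', hyu⟩).not_ge

/-- In the Cartesian tree of `G`, the subtree of `u` consists of the vertices reachable from `u`
through vertices of priority at least `p u`. -/
theorem isCartesianTree_iff (hp : Function.Injective p) :
    IsCartesianTree G p T ↔ ∀ u v, T.ancestor u v ↔ ReachableAbove G p (p u) u v := by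
  refine ⟨fun hT u v => ⟨hT.reachableAbove_of_ancestor, hT.ancestor_of_reachableAbove⟩,
    fun h => ⟨⟨fun v => ?_, fun u v huv => ?_⟩, fun u v huv => ?_⟩⟩
  · rw [SimpleGraph.connected_iff_exists_forall_reachable]
    refine ⟨⟨v, RTree.ancestor_refl v⟩, fun ⟨w, hw⟩ => ?_⟩
    have hvw := (h v w).1 hw
    induction hvw with
    | refl => exact .refl _
    | @tail x y hx hxy ih =>
      have hxT := (h v x).2 hx
      refine (ih hxT).trans (SimpleGraph.Adj.reachable ?_)
      exact hxy.1
  · obtain hle | hle := le_total (p u) (p v)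
    · exact .inl ((h u v).2 (.single ⟨huv, hle⟩))
    · exact .inr ((h v u).2 (.single ⟨huv.symm, hle⟩))
  · exact (((h u v).1 huv.1).le le_rfl).lt_of_ne (hp.ne huv.2)

end Characterization

/-- Adding an edge to a tree and removing another edge of the cycle this closes gives a tree. -/
theorem SimpleGraph.IsTree.exchange {α : Type*} [Finite α] {H : SimpleGraph α} (hH : H.IsTree)
    {u v x y : α} (huv : u ≠ v) (hadj : ¬ H.Adj u v) {q : H.Walk u v} (hq : q.IsPath)
    (hxy : s(x, y) ∈ q.edges) :
    ∃ H' : SimpleGraph α, H'.IsTree ∧ H'.edgeSet = insert s(u, v) (H.edgeSet \ {s(x, y)}) := by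
  have hne : s(u, v) ≠ s(x, y) := fun h => hadj (q.edges_subset_edgeSet (h ▸ hxy))
  have hxyH : s(x, y) ∈ H.edgeSet := q.edges_subset_edgeSet hxy
  set K := H ⊔ SimpleGraph.edge u v with hK
  have hHK : H ≤ K := le_sup_left
  have hKvu : K.Adj v u := by
    simp [hK, SimpleGraph.edge_adj, huv, huv.symm]
  have hcyc : (SimpleGraph.Walk.cons hKvu (q.mapLe hHK)).IsCycle := by
    rw [SimpleGraph.Walk.cons_isCycle_iff]
    refine ⟨hq.mapLe hHK, fun h => hadj ?_⟩
    rw [SimpleGraph.Walk.edges_mapLe_eq_edges, Sym2.eq_swap] at h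
    exact q.edges_subset_edgeSet h
  have hbr : ¬ K.IsBridge s(x, y) := fun h => h.notMem_edges_of_isCycle hcyc (by simp [hxy])
  have hedge : (K.deleteEdges {s(x, y)}).edgeSet = insert s(u, v) (H.edgeSet \ {s(x, y)}) := by
    rw [SimpleGraph.edgeSet_deleteEdges, hK, SimpleGraph.edgeSet_sup,
      SimpleGraph.edgeSet_edge_of_ne huv]
    ext e
    by_cases he : e = s(u, v) <;> simp_all
  refine ⟨K.deleteEdges {s(x, y)}, ?_, hedge⟩
  rw [SimpleGraph.isTree_iff_connected_and_card] at hH ⊢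
  refine ⟨(hH.1.mono hHK).connected_delete_edge_of_not_isBridge hbr, ?_⟩
  rw [← hH.2, hedge, Nat.card_coe_set_eq, Nat.card_coe_set_eq,
    Set.ncard_exchange (by exact hadj) hxyH]

section MaxSpanningTree

variable {α : Type*} [Finite α] {G H : SimpleGraph α} {p : α → ℝ}

theorem reachableAbove_of_adj_of_maxSpanningTree (hHG : H ≤ G) (hH : H.IsTree)
    (hmax : ∀ H' : SimpleGraph α, H' ≤ G → H'.IsTree →
      ∑ᶠ e ∈ H'.edgeSet, wmin p e ≤ ∑ᶠ e ∈ H.edgeSet, wmin p e)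
    {t : ℝ} {u v : α} (huv : G.Adj u v) (hu : t ≤ p u) (hv : t ≤ p v) :
    ReachableAbove H p t u v := by
  by_contra hcon
  have hadj : ¬ H.Adj u v := fun h => hcon (.single ⟨h, hv⟩)
  obtain ⟨q, hq⟩ := hH.connected.exists_isPath u v
  obtain ⟨d, hd, hd₁, hd₂⟩ := q.exists_boundary_dart {w | ReachableAbove H p t u w} .refl hcon
  have hlt : p d.snd < t := lt_of_not_ge fun h => hd₂ (hd₁.tail ⟨d.adj, h⟩)
  have hdq : s(d.fst, d.snd) ∈ q.edges := List.mem_map_of_mem hd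
  obtain ⟨H', hH', hE⟩ := hH.exchange huv.ne hadj hq hdq
  have hdH : s(d.fst, d.snd) ∈ H.edgeSet := d.adj
  have hle : H' ≤ G := by
    rw [← SimpleGraph.edgeSet_subset_edgeSet, hE]
    exact Set.insert_subset huv (Set.sdiff_subset.trans (SimpleGraph.edgeSet_mono hHG))
  have key := hmax H' hle hH'
  have hH_eq : H.edgeSet = insert s(d.fst, d.snd) (H.edgeSet \ {s(d.fst, d.snd)}) := by
    rw [Set.insert_sdiff_singleton, Set.insert_eq_of_mem hdH]
  have huvE : s(u, v) ∉ H.edgeSet \ {s(d.fst, d.snd)} := fun h => hadj h.1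
  rw [hE, finsum_mem_insert _ huvE (Set.toFinite _)] at key
  conv_rhs at key => rw [hH_eq]
  rw [finsum_mem_insert _ (by simp) (Set.toFinite _)] at key
  have h₁ : wmin p s(d.fst, d.snd) < t := min_lt_of_right_lt hlt
  have h₂ : t ≤ wmin p s(u, v) := le_min hu hv
  linarith

/-- A maximum spanning tree has the same connectivity as `G` above every priority threshold. -/
theorem reachableAbove_iff_of_maxSpanningTree (hHG : H ≤ G) (hH : H.IsTree)
    (hmax : ∀ H' : SimpleGraph α, H' ≤ G → H'.IsTree →
      ∑ᶠ e ∈ H'.edgeSet, wmin p e ≤ ∑ᶠ e ∈ H.edgeSet, wmin p e)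
    {t : ℝ} {u v : α} (hu : t ≤ p u) :
    ReachableAbove G p t u v ↔ ReachableAbove H p t u v := by
  refine ⟨fun h => ?_, Relation.ReflTransGen.mono (fun x y hxy => ⟨hHG hxy.1, hxy.2⟩) _ _⟩
  induction h with
  | refl => exact .refl
  | tail hx hxy ih =>
    exact ih.trans
      (reachableAbove_of_adj_of_maxSpanningTree hHG hH hmax hxy.1 (ih.le hu) hxy.2)

end MaxSpanningTree

/-- If `H` is a maximum spanning tree of `(G, w^min_p)`, then `Ind(G,p) = Ind(H,p)`. -/
theorem cartesianTree_maxSpanningTree {α : Type*} [Fintype α]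
    (G H : SimpleGraph α) (hG : G.Connected) (p : α → ℝ) (hp : Function.Injective p)
    (hHG : H ≤ G) (hH : H.IsTree)
    (hmax : ∀ H' : SimpleGraph α, H' ≤ G → H'.IsTree →
      ∑ᶠ e ∈ H'.edgeSet, wmin p e ≤ ∑ᶠ e ∈ H.edgeSet, wmin p e) :
    ∀ S : RTree α, IsCartesianTree G p S ↔ IsCartesianTree H p S := by
  intro S
  rw [isCartesianTree_iff hp, isCartesianTree_iff hp]
  exact forall₂_congr fun u v =>
    iff_congr .rfl (reachableAbove_iff_of_maxSpanningTree hHG hH hmax le_rfl)
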